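/- Let n ≥ 2 be a natural number and t₁ > 1 a real number. Then there is no continuous function m : ℝ → ℝ satisfying −m(t) ≥ (1/(n−1))·∫₁ᵗ m(s)² ds + 2n for every t with t₁ ≤ t ≤ t₁ + 2. -/

import Mathlib

open MeasureTheory

/-- The finite-time blow-up contradiction in Section 5 of the paper: no continuous `m`
can satisfy `−m(t) ≥ (1/(n−1))·∫₁ᵗ m² + 2n` on the whole interval `[t₁, t₁ + 2]`. -/
theorem stmt_16 (n : ℕ) (hn : 2 ≤ n) (t₁ : ℝ) (ht₁ : 1 < t₁) :
    ¬ ∃ m : ℝ → ℝ, Continuous m ∧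
      ∀ t, t₁ ≤ t → t ≤ t₁ + 2 →
        (1 / ((n : ℝ) - 1)) * (∫ s in (1 : ℝ)..t, (m s) ^ 2) + 2 * (n : ℝ) ≤ -m t := by
  rintro ⟨m, hm, h⟩
  have hn' : (2 : ℝ) ≤ n := by exact_mod_cast hn
  have hd : (0 : ℝ) < (n : ℝ) - 1 := by linarith
  set c : ℝ := 1 / ((n : ℝ) - 1) with hc
  have hc0 : 0 < c := by positivity
  have hcn : c * ((n : ℝ) - 1) = 1 := by rw [hc]; field_simp
  set F : ℝ → ℝ := fun t => c * (∫ s in (1 : ℝ)..t, (m s) ^ 2) + 2 * (n : ℝ) with hF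
  have hm2 : Continuous fun s => (m s) ^ 2 := by fun_prop
  have hFd : ∀ t, HasDerivAt F (c * (m t) ^ 2) t := fun t =>
    ((hm2.integral_hasStrictDerivAt 1 t).hasDerivAt.const_mul c).add_const _
  have hFge : ∀ t, t₁ ≤ t → 2 * (n : ℝ) ≤ F t := by
    intro t ht
    have : 0 ≤ ∫ s in (1 : ℝ)..t, (m s) ^ 2 :=
      intervalIntegral.integral_nonneg (by linarith) (fun s _ => sq_nonneg _)
    have := mul_nonneg hc0.le this
    simp only [hF]; linarith
  have hFpos : ∀ t, t₁ ≤ t → 0 < F t := fun t ht => by linarith [hFge t ht]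
  have hGd : ∀ t, t₁ ≤ t → HasDerivAt (fun t => (F t)⁻¹) (-(c * (m t) ^ 2) / F t ^ 2) t :=
    fun t ht => (hFd t).fun_inv (hFpos t ht).ne'
  obtain ⟨x, hx, hs⟩ := exists_hasDerivAt_eq_slope (fun t => (F t)⁻¹)
    (fun t => -(c * (m t) ^ 2) / F t ^ 2) (show t₁ < t₁ + 2 by linarith)
    (fun t ht => (hGd t ht.1).continuousAt.continuousWithinAt)
    (fun t ht => hGd t ht.1.le)
  have hxF := hFpos x hx.1.le
  have h1 : F x ≤ -m x := h x hx.1.le hx.2.le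
  have h2 : F x ^ 2 ≤ m x ^ 2 := by nlinarith
  have h3 : -(c * (m x) ^ 2) / F x ^ 2 ≤ -c := by
    rw [div_le_iff₀ (by positivity)]; nlinarith
  have h4 : 0 < (F (t₁ + 2))⁻¹ := inv_pos.2 (hFpos _ (by linarith))
  have h5 : (F t₁)⁻¹ ≤ (2 * (n : ℝ))⁻¹ := inv_anti₀ (by linarith) (hFge _ le_rfl)
  have h6 : (2 * (n : ℝ))⁻¹ * (2 * n) = 1 := inv_mul_cancel₀ (by linarith)
  have h7 : 2 * c < (2 * (n : ℝ))⁻¹ := by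
    rw [hs, show t₁ + 2 - t₁ = 2 by ring, div_le_iff₀ (by norm_num)] at h3
    linarith
  nlinarith
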